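/- Lyapunov dissipation inequality for the delayed system: let A, B be real n×n matrices, let H and C₀ be symmetric positive definite real n×n matrices satisfying AᵀHA − H = −C₀, and define α, β from H, C₀, A, B as in the context. Then for all vectors x, y ∈ ℝⁿ, (Ax + By)ᵀ H (Ax + By) ≤ α·(xᵀHx) + β·(yᵀHy). -/

import Mathlib

open Matrix

/-- The ℓ²→ℓ² operator norm of a real square matrix. -/
noncomputable def opNorm {n : ℕ} (M : Matrix (Fin n) (Fin n) ℝ) : ℝ :=
  ‖Matrix.toEuclideanCLM (𝕜 := ℝ) M‖

theorem Matrix.IsHermitian.exists_weights_dotProduct_mulVec {n : ℕ}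
    {H : Matrix (Fin n) (Fin n) ℝ} (hH : H.IsHermitian) (x : Fin n → ℝ) :
    ∃ w : Fin n → ℝ, (∀ i, 0 ≤ w i) ∧ ∑ i, w i = x ⬝ᵥ x ∧
      ∑ i, hH.eigenvalues i * w i = x ⬝ᵥ H.mulVec x := by
  have hsum (y : Fin n → ℝ) :
      ∑ i, (x ⬝ᵥ (hH.eigenvectorBasis i).ofLp) * ((hH.eigenvectorBasis i).ofLp ⬝ᵥ y) = x ⬝ᵥ y := by
    have h := hH.eigenvectorBasis.sum_inner_mul_inner (WithLp.toLp 2 x) (WithLp.toLp 2 y)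
    simpa [EuclideanSpace.inner_eq_star_dotProduct, dotProduct_comm] using h
  have hT : Hᵀ = H := by simpa [conjTranspose_eq_transpose_of_trivial] using hH.eq
  refine ⟨fun i => (x ⬝ᵥ (hH.eigenvectorBasis i).ofLp) ^ 2, fun i => sq_nonneg _, ?_, ?_⟩
  · rw [← hsum x]
    exact Finset.sum_congr rfl fun i _ => by
      rw [dotProduct_comm _ x, ← sq]
  · rw [← hsum (H.mulVec x)]
    refine Finset.sum_congr rfl fun i _ => ?_
    rw [dotProduct_mulVec, ← mulVec_transpose, hT, hH.mulVec_eigenvectorBasis, smul_dotProduct,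
      dotProduct_comm _ x, smul_eq_mul]
    ring

theorem Matrix.IsHermitian.mul_dotProduct_self_le {n : ℕ} {H : Matrix (Fin n) (Fin n) ℝ}
    (hH : H.IsHermitian) {a : ℝ} (ha : a ∈ lowerBounds (Set.range hH.eigenvalues))
    (x : Fin n → ℝ) : a * (x ⬝ᵥ x) ≤ x ⬝ᵥ H.mulVec x := by
  obtain ⟨w, hw, h₁, h₂⟩ := hH.exists_weights_dotProduct_mulVec x
  rw [← h₁, ← h₂, Finset.mul_sum]
  exact Finset.sum_le_sum fun i _ => mul_le_mul_of_nonneg_right (ha ⟨i, rfl⟩) (hw i)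

theorem Matrix.IsHermitian.dotProduct_mulVec_le {n : ℕ} {H : Matrix (Fin n) (Fin n) ℝ}
    (hH : H.IsHermitian) {a : ℝ} (ha : a ∈ upperBounds (Set.range hH.eigenvalues))
    (x : Fin n → ℝ) : x ⬝ᵥ H.mulVec x ≤ a * (x ⬝ᵥ x) := by
  obtain ⟨w, hw, h₁, h₂⟩ := hH.exists_weights_dotProduct_mulVec x
  rw [← h₁, ← h₂, Finset.mul_sum]
  exact Finset.sum_le_sum fun i _ => mul_le_mul_of_nonneg_right (ha ⟨i, rfl⟩) (hw i)

theorem opNorm_nonneg {n : ℕ} (M : Matrix (Fin n) (Fin n) ℝ) : 0 ≤ opNorm M :=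
  norm_nonneg _

theorem dotProduct_self_eq_norm_sq {n : ℕ} (x : Fin n → ℝ) :
    x ⬝ᵥ x = ‖WithLp.toLp 2 x‖ ^ 2 := by
  rw [EuclideanSpace.real_norm_sq_eq]
  exact Finset.sum_congr rfl fun i _ => (sq (x i)).symm

theorem dotProduct_mulVec_le_opNorm {n : ℕ} (M : Matrix (Fin n) (Fin n) ℝ) (x y : Fin n → ℝ) :
    x ⬝ᵥ M.mulVec y ≤ opNorm M * (‖WithLp.toLp 2 x‖ * ‖WithLp.toLp 2 y‖) := by
  have h := real_inner_le_norm (WithLp.toLp 2 x)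
    (Matrix.toEuclideanCLM (𝕜 := ℝ) M (WithLp.toLp 2 y))
  have h' := (Matrix.toEuclideanCLM (𝕜 := ℝ) M).le_opNorm (WithLp.toLp 2 y)
  have e : inner ℝ (WithLp.toLp 2 x) (Matrix.toEuclideanCLM (𝕜 := ℝ) M (WithLp.toLp 2 y)) =
      x ⬝ᵥ M.mulVec y := by
    simp [EuclideanSpace.inner_eq_star_dotProduct, dotProduct_comm]
  rw [e] at h
  calc _ ≤ _ := h
    _ ≤ ‖WithLp.toLp 2 x‖ * (opNorm M * ‖WithLp.toLp 2 y‖) :=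
        mul_le_mul_of_nonneg_left h' (norm_nonneg _)
    _ = _ := by ring

theorem stmt2 {n : ℕ} (A B H C₀ : Matrix (Fin n) (Fin n) ℝ)
    (hH : H.PosDef) (hC : C₀.PosDef)
    (hLyap : Aᵀ * H * A - H = -C₀)
    (c ηlo ηhi : ℝ)
    (hc : IsLeast (Set.range hC.1.eigenvalues) c)
    (hηlo : IsLeast (Set.range hH.1.eigenvalues) ηlo)
    (hηhi : IsGreatest (Set.range hH.1.eigenvalues) ηhi)
    (α β : ℝ)
    (hα : α = if opNorm (Aᵀ * H * B) < c
      then |ηhi - c + opNorm (Aᵀ * H * B)| / ηhi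
      else |ηlo - c + opNorm (Aᵀ * H * B)| / ηlo)
    (hβ : β = (opNorm (Aᵀ * H * B) + opNorm (Bᵀ * H * B)) / ηlo)
    (x y : Fin n → ℝ) :
    (A.mulVec x + B.mulVec y) ⬝ᵥ H.mulVec (A.mulVec x + B.mulVec y) ≤
      α * (x ⬝ᵥ H.mulVec x) + β * (y ⬝ᵥ H.mulVec y) := by
  have hlo : 0 < ηlo := by
    obtain ⟨i, rfl⟩ := hηlo.1
    exact hH.eigenvalues_pos i
  have hhi : 0 < ηhi := by
    obtain ⟨i, rfl⟩ := hηhi.1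
    exact hH.eigenvalues_pos i
  have hT : Hᵀ = H := by simpa [conjTranspose_eq_transpose_of_trivial] using hH.1.eq
  have adj (M N : Matrix (Fin n) (Fin n) ℝ) (u v : Fin n → ℝ) :
      M.mulVec u ⬝ᵥ H.mulVec (N.mulVec v) = u ⬝ᵥ (Mᵀ * H * N).mulVec v := by
    simp only [← mulVec_mulVec]
    rw [dotProduct_mulVec u, vecMul_transpose]
  have hsymm : B.mulVec y ⬝ᵥ H.mulVec (A.mulVec x) = x ⬝ᵥ (Aᵀ * H * B).mulVec y := by
    rw [← adj, dotProduct_mulVec, ← mulVec_transpose, hT, dotProduct_comm]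
  have expand : (A.mulVec x + B.mulVec y) ⬝ᵥ H.mulVec (A.mulVec x + B.mulVec y) =
      x ⬝ᵥ H.mulVec x - x ⬝ᵥ C₀.mulVec x + 2 * (x ⬝ᵥ (Aᵀ * H * B).mulVec y) +
        y ⬝ᵥ (Bᵀ * H * B).mulVec y := by
    have hA : Aᵀ * H * A = H - C₀ := by rw [sub_eq_iff_eq_add.mp hLyap]; abel
    rw [mulVec_add, add_dotProduct, dotProduct_add, dotProduct_add, hsymm, adj, adj, adj, hA,
      sub_mulVec, dotProduct_sub]
    ring
  have hm := opNorm_nonneg (Aᵀ * H * B)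
  have hb := opNorm_nonneg (Bᵀ * H * B)
  have hxy := dotProduct_mulVec_le_opNorm (Aᵀ * H * B) x y
  have hyy := dotProduct_mulVec_le_opNorm (Bᵀ * H * B) y y
  have hCx := hC.1.mul_dotProduct_self_le hc.2 x
  have hlox := hH.1.mul_dotProduct_self_le hηlo.2 x
  have hloy := hH.1.mul_dotProduct_self_le hηlo.2 y
  have hhix := hH.1.dotProduct_mulVec_le hηhi.2 x
  rw [expand]
  simp only [dotProduct_self_eq_norm_sq] at hCx hlox hloy hhix
  generalize opNorm (Aᵀ * H * B) = m at *
  generalize opNorm (Bᵀ * H * B) = b at *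
  generalize x ⬝ᵥ H.mulVec x = V at *
  generalize y ⬝ᵥ H.mulVec y = W at *
  generalize ‖WithLp.toLp 2 x‖ = p at *
  generalize ‖WithLp.toLp 2 y‖ = q at *
  have hV : 0 ≤ V := (by positivity : 0 ≤ ηlo * p ^ 2).trans hlox
  have hβW : (m + b) * q ^ 2 ≤ β * W := by
    rw [hβ, div_mul_eq_mul_div, le_div_iff₀ hlo, mul_assoc, mul_comm (q ^ 2)]
    exact mul_le_mul_of_nonneg_left hloy (add_nonneg hm hb)
  have hαV : V - (c - m) * p ^ 2 ≤ α * V := by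
    rw [hα]
    split_ifs with h
    · calc _ ≤ (ηhi - c + m) / ηhi * V := by
            rw [div_mul_eq_mul_div, le_div_iff₀ hhi]
            nlinarith [mul_le_mul_of_nonneg_left hhix (sub_nonneg.mpr h.le)]
        _ ≤ _ := by gcongr; exact le_abs_self _
    · calc _ ≤ (ηlo - c + m) / ηlo * V := by
            rw [div_mul_eq_mul_div, le_div_iff₀ hlo]
            nlinarith [mul_le_mul_of_nonneg_left hlox (sub_nonneg.mpr (not_lt.mp h))]
        _ ≤ _ := by gcongr; exact le_abs_self _
  nlinarith [mul_nonneg hm (sq_nonneg (p - q))]
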